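/- Let R be a Noetherian ring and 𝔞 ⊊ R a proper ideal. Every finite R-module M with cd(𝔞,M) = 1 is an RCMF module with respect to 𝔞; in particular, with cd-filtration M₀ ⊆ M₁ = M, the quotient M/M₀ is relative Cohen-Macaulay with respect to 𝔞 with grade(𝔞, M/M₀) = cd(𝔞, M/M₀) = 1. -/

import Mathlib

open CategoryTheory

noncomputable section

/-- The cohomological dimension `cd(𝔞, M)`: the supremum (in `ℕ`) of the set of
indices `i` with `H^i_𝔞(M) ≠ 0`, local cohomology being taken w.r.t. `𝔞`. -/
def cohDim {R : Type} [CommRing R] (I : Ideal R) (M : Type) [AddCommGroup M] [Module R M] : ℕ :=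
  sSup {i : ℕ | Nontrivial ((localCohomology I i).obj (ModuleCat.of R M))}

/-- `M` is relative Cohen-Macaulay w.r.t. `𝔞` if there is precisely one non-vanishing
local cohomology module of `M` w.r.t. `𝔞`. -/
def IsRelCM {R : Type} [CommRing R] (I : Ideal R) (M : Type) [AddCommGroup M] [Module R M] :
    Prop :=
  ∃ c : ℕ, ∀ i : ℕ, Nontrivial ((localCohomology I i).obj (ModuleCat.of R M)) ↔ i = c

/-- `f : K →ₗ[R] E` exhibits `E` as an injective hull of `K`:
`E` is an injective module and `f` is an essential monomorphism. -/
structure IsInjectiveHull (R : Type) [CommRing R] {K E : Type} [AddCommGroup K] [Module R K]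
    [AddCommGroup E] [Module R E] (f : K →ₗ[R] E) : Prop where
  injective : Module.Injective R E
  inj : Function.Injective f
  essential : ∀ N : Submodule R E, N ≠ ⊥ → N ⊓ LinearMap.range f ≠ ⊥

/-- `F` is the cohomological dimension filtration (cd-filtration) of `M` in the range
`0 ≤ i ≤ c`: `F i` is the largest submodule of `M` of cohomological dimension `≤ i`. -/
def IsCdFiltration {R : Type} [CommRing R] (I : Ideal R) {M : Type} [AddCommGroup M]
    [Module R M] (c : ℕ) (F : ℕ → Submodule R M) : Prop :=
  ∀ i ≤ c, cohDim I (F i) ≤ i ∧ ∀ N : Submodule R M, cohDim I N ≤ i → N ≤ F i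

/-- The `i`-th factor `M_i / M_{i-1}` of a filtration `F` of `M`. -/
def filtFactor {R : Type} [CommRing R] {M : Type} [AddCommGroup M] [Module R M]
    (F : ℕ → Submodule R M) (i : ℕ) : Type :=
  ↥(F i) ⧸ Submodule.comap (F i).subtype (F (i - 1))

instance {R : Type} [CommRing R] {M : Type} [AddCommGroup M] [Module R M]
    (F : ℕ → Submodule R M) (i : ℕ) : AddCommGroup (filtFactor F i) :=
  inferInstanceAs (AddCommGroup (↥(F i) ⧸ Submodule.comap (F i).subtype (F (i - 1))))

instance {R : Type} [CommRing R] {M : Type} [AddCommGroup M] [Module R M]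
    (F : ℕ → Submodule R M) (i : ℕ) : Module R (filtFactor F i) :=
  inferInstanceAs (Module R (↥(F i) ⧸ Submodule.comap (F i).subtype (F (i - 1))))

/-- `M` is a relative Cohen-Macaulay filtered (RCMF) module w.r.t. `𝔞`: every factor
`M_i/M_{i-1}` (`1 ≤ i ≤ c = cd(𝔞,M)`) of its cd-filtration is either zero or an
`i`-cohomological dimensional relative Cohen-Macaulay module w.r.t. `𝔞`. -/
def IsRCMF {R : Type} [CommRing R] (I : Ideal R) (M : Type) [AddCommGroup M] [Module R M] :
    Prop :=
  ∀ F : ℕ → Submodule R M, IsCdFiltration I (cohDim I M) F →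
    ∀ i : ℕ, 1 ≤ i → i ≤ cohDim I M →
      Subsingleton (filtFactor F i) ∨
        (IsRelCM I (filtFactor F i) ∧ cohDim I (filtFactor F i) = i)

end

/-- The grade `grade(𝔞, M) = inf {i : Ext^i_R(R/𝔞, M) ≠ 0}` (infimum in `ℕ`). -/
noncomputable def gradeI {R : Type} [CommRing R] (I : Ideal R) (M : Type) [AddCommGroup M]
    [Module R M] : ℕ :=
  sInf {i : ℕ | Nontrivial
    (((Ext R (ModuleCat R) i).obj (Opposite.op (ModuleCat.of R (R ⧸ I)))).obj
      (ModuleCat.of R M))}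

noncomputable section
namespace LC
open Opposite Limits
variable {R : Type} [CommRing R]

def yonMap {X X' : ChainComplex (ModuleCat.{0} R) ℕ} (φ : X' ⟶ X) (Y : ModuleCat.{0} R) :
    X.linearYonedaObj R Y ⟶ X'.linearYonedaObj R Y :=
  (HomologicalComplex.unopFunctor _ _).map
    ((((linearYoneda R (ModuleCat.{0} R)).obj Y).rightOp.mapHomologicalComplex _).map φ).op

lemma yonMap_f_apply {X X' : ChainComplex (ModuleCat.{0} R) ℕ} (φ : X' ⟶ X) (Y : ModuleCat.{0} R)
    (n : ℕ) (f : X.X n ⟶ Y) : (yonMap φ Y).f n f = (φ.f n ≫ f : X'.X n ⟶ Y) := rfl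

lemma yon_d_apply (X : ChainComplex (ModuleCat.{0} R) ℕ) (Y : ModuleCat.{0} R)
    (n m : ℕ) (f : X.X n ⟶ Y) :
    (X.linearYonedaObj R Y).d n m f = (X.d m n ≫ f : X.X m ⟶ Y) := rfl

lemma aux_iso {C : Type*} [Category C] {E E' H H' K K' : C} (m : E ⟶ E') (a : E ⟶ H)
    (a' : E' ⟶ H') (W : H ⟶ H') (k : K ≅ H) (k' : K' ≅ H') (y : K ⟶ K')
    (e1 : m ≫ a' = a ≫ W) (e2 : k.hom ≫ W = y ≫ k'.hom) :
    m ≫ a' ≫ k'.inv = (a ≫ k.inv) ≫ y := by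
  have e3 : W ≫ k'.inv = k.inv ≫ y := by
    rw [Iso.comp_inv_eq, Category.assoc, Iso.eq_inv_comp, e2]
  rw [← Category.assoc, e1, Category.assoc, e3, Category.assoc]

lemma isoExt_naturality {X X' Y : ModuleCat.{0} R} (g : X' ⟶ X) (P' : ProjectiveResolution X')
    (P : ProjectiveResolution X) (φ : ProjectiveResolution.Hom P' P g) (n : ℕ) :
    ((Ext R (ModuleCat.{0} R) n).map g.op).app Y ≫ (P'.isoExt n Y).hom =
      (P.isoExt n Y).hom ≫ HomologicalComplex.homologyMap (yonMap φ.hom Y) n := by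
  have h := ProjectiveResolution.isoLeftDerivedObj_inv_naturality g P' P φ.hom
    (by simpa using φ.hom_f_zero_comp_π_f_zero) ((linearYoneda R (ModuleCat.{0} R)).obj Y).rightOp n
  have h' := congrArg Quiver.Hom.unop h
  have h2 := congrArg Quiver.Hom.unop (HomologicalComplex.homologyOp_hom_naturality (yonMap φ.hom Y) n)
  set A := (P'.isoLeftDerivedObj ((linearYoneda R (ModuleCat.{0} R)).obj Y).rightOp n)
  set B := (P.isoLeftDerivedObj ((linearYoneda R (ModuleCat.{0} R)).obj Y).rightOp n)
  set K := HomologicalComplex.homologyUnop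
    ((((linearYoneda R (ModuleCat.{0} R)).obj Y).rightOp.mapHomologicalComplex _).obj P.complex) n
  set K' := HomologicalComplex.homologyUnop
    ((((linearYoneda R (ModuleCat.{0} R)).obj Y).rightOp.mapHomologicalComplex _).obj P'.complex) n
  let W := (HomologicalComplex.homologyMap
      ((((linearYoneda R (ModuleCat.{0} R)).obj Y).rightOp.mapHomologicalComplex _).map φ.hom) n).unop
  have e1 : ((Ext R (ModuleCat.{0} R) n).map g.op).app Y ≫ A.inv.unop = B.inv.unop ≫ W := h'
  have e2 : K.hom ≫ W = HomologicalComplex.homologyMap (yonMap φ.hom Y) n ≫ K'.hom := h2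
  exact aux_iso (E := ((Ext R (ModuleCat.{0} R) n).obj (op X)).obj Y)
    (E' := ((Ext R (ModuleCat.{0} R) n).obj (op X')).obj Y)
    (K := (P.complex.linearYonedaObj R Y).homology n)
    (K' := (P'.complex.linearYonedaObj R Y).homology n)
    (((Ext R (ModuleCat.{0} R) n).map g.op).app Y) B.inv.unop A.inv.unop W K K'
    (HomologicalComplex.homologyMap (yonMap φ.hom Y) n) e1 e2

/-- class in the old Ext of a cocycle -/
def oldMk {X Y : ModuleCat.{0} R} (P : ProjectiveResolution X) (n : ℕ)
    (z : (P.complex.linearYonedaObj R Y).cycles n) :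
    (((Ext R (ModuleCat.{0} R) n).obj (op X)).obj Y : ModuleCat R) :=
  (P.isoExt n Y).inv ((P.complex.linearYonedaObj R Y).homologyπ n z)

lemma oldMk_surj {X Y : ModuleCat.{0} R} (P : ProjectiveResolution X) (n : ℕ)
    (e : (((Ext R (ModuleCat.{0} R) n).obj (op X)).obj Y : ModuleCat R)) :
    ∃ z, oldMk P n z = e := by
  obtain ⟨z, hz⟩ := (ModuleCat.epi_iff_surjective
    ((P.complex.linearYonedaObj R Y).homologyπ n)).1 inferInstance ((P.isoExt n Y).hom e)
  refine ⟨z, ?_⟩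
  simp [oldMk, hz]

def toHom {X Y : ModuleCat.{0} R} {P : ProjectiveResolution X} {n : ℕ}
    (z : (P.complex.linearYonedaObj R Y).cycles n) : P.complex.X n ⟶ Y :=
  (P.complex.linearYonedaObj R Y).iCycles n z

lemma toHom_d {X Y : ModuleCat.{0} R} {P : ProjectiveResolution X} {n : ℕ}
    (z : (P.complex.linearYonedaObj R Y).cycles n) (m : ℕ) :
    P.complex.d m n ≫ toHom z = 0 := by
  have := (P.complex.linearYonedaObj R Y).iCycles_d n m
  have := congrArg (fun f => f.hom z) this
  exact this

lemma toHom_surj {X Y : ModuleCat.{0} R} {P : ProjectiveResolution X} {n : ℕ}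
    (f : P.complex.X n ⟶ Y) (hf : P.complex.d (n+1) n ≫ f = 0) :
    ∃ z : (P.complex.linearYonedaObj R Y).cycles n, toHom z = f := by
  refine ⟨(P.complex.linearYonedaObj R Y).cyclesMk (i := n) f (n+1) (by simp) hf, ?_⟩
  exact (P.complex.linearYonedaObj R Y).i_cyclesMk (i := n) f (n+1) (by simp) hf

lemma oldMk_eq_zero_iff {X Y : ModuleCat.{0} R} (P : ProjectiveResolution X) (n : ℕ)
    (z : (P.complex.linearYonedaObj R Y).cycles n) :
    oldMk P n z = 0 ↔ ∃ g : P.complex.X ((ComplexShape.up ℕ).prev n) ⟶ Y,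
      P.complex.d n _ ≫ g = toHom z := by
  let K := P.complex.linearYonedaObj R Y
  have hex : (ShortComplex.mk (K.toCycles ((ComplexShape.up ℕ).prev n) n) (K.homologyπ n)
      (by simp)).Exact :=
    ShortComplex.exact_of_g_is_cokernel _ (K.homologyIsCokernel _ n rfl)
  rw [ShortComplex.moduleCat_exact_iff] at hex
  have hinj : Function.Injective (K.iCycles n) := (ModuleCat.mono_iff_injective _).1 inferInstance
  have hz : oldMk P n z = 0 ↔ K.homologyπ n z = 0 := by
    constructor
    · intro h
      have h2 := congrArg (P.isoExt n Y).hom h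
      simpa [oldMk] using h2
    · intro h
      have h2 := congrArg (P.isoExt n Y).inv h
      simpa [oldMk] using h2
  rw [hz]
  constructor
  · intro h
    obtain ⟨g, hg⟩ := hex z h
    refine ⟨g, ?_⟩
    have := congrArg (fun f => f.hom g) (K.toCycles_i ((ComplexShape.up ℕ).prev n) n)
    have h3 : K.d _ n g = K.iCycles n z := by
      rw [← hg]; exact this.symm
    exact h3
  · rintro ⟨g, hg⟩
    have := congrArg (fun f => f.hom g) (K.toCycles_i ((ComplexShape.up ℕ).prev n) n)
    have h4 : K.toCycles ((ComplexShape.up ℕ).prev n) n g = z := by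
      apply hinj
      exact this.trans hg
    have h5 := congrArg (fun f => f.hom g) (K.toCycles_comp_homologyπ ((ComplexShape.up ℕ).prev n) n)
    rw [← h4]
    exact h5

lemma oldMk_map {X X' Y : ModuleCat.{0} R} (g : X' ⟶ X) (P' : ProjectiveResolution X')
    (P : ProjectiveResolution X) (φ : ProjectiveResolution.Hom P' P g) (n : ℕ)
    (z : (P.complex.linearYonedaObj R Y).cycles n) :
    ∃ z' : (P'.complex.linearYonedaObj R Y).cycles n,
    ((Ext R (ModuleCat.{0} R) n).map g.op).app Y (oldMk P n z) = oldMk P' n z' ∧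
      toHom z' = φ.hom.f n ≫ toHom z := by
  refine ⟨HomologicalComplex.cyclesMap (yonMap φ.hom Y) n z, ?_, ?_⟩
  · have h := congrArg (fun f => f.hom (oldMk (R := R) P n z)) (isoExt_naturality (Y := Y) g P' P φ n)
    have h2 := congrArg (fun f => f.hom z)
      (HomologicalComplex.homologyπ_naturality (yonMap φ.hom Y) n)
    have h3 : (P.isoExt n Y).hom (oldMk P n z) =
      (P.complex.linearYonedaObj R Y).homologyπ n z := by simp [oldMk]
    have hinj : Function.Injective (P'.isoExt (R := R) n Y).hom :=
      (ModuleCat.mono_iff_injective _).1 inferInstance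
    apply hinj
    refine h.trans ?_
    change HomologicalComplex.homologyMap (yonMap φ.hom Y) n
      ((P.isoExt n Y).hom (oldMk P n z)) = _
    rw [h3]
    refine h2.trans ?_
    simp [oldMk]
  · have h := congrArg (fun f => f.hom z)
      (HomologicalComplex.cyclesMap_i (yonMap φ.hom Y) n)
    exact h

lemma extMk_eq_zero_iff' {X Y : ModuleCat.{0} R} (P : ProjectiveResolution X) (n : ℕ)
    (f : P.complex.X n ⟶ Y) (hf : P.complex.d (n+1) n ≫ f = 0) :
    P.extMk f (n+1) rfl hf = 0 ↔ ∃ g : P.complex.X ((ComplexShape.up ℕ).prev n) ⟶ Y,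
      P.complex.d n _ ≫ g = f := by
  cases n with
  | succ n =>
    rw [P.extMk_eq_zero_iff f _ rfl hf n rfl]
    have : (ComplexShape.up ℕ).prev (n+1) = n := by simp
    rw [this]
  | zero =>
    have h0 : P.complex.d 0 ((ComplexShape.up ℕ).prev 0) = 0 :=
      P.complex.shape _ _ (by simp)
    rw [h0]
    constructor
    · intro h
      refine ⟨0, ?_⟩
      simp only [← P.extEquivCohomologyClass.apply_eq_iff_eq,
        ProjectiveResolution.extEquivCohomologyClass_extMk,
        ProjectiveResolution.extEquivCohomologyClass_zero,
        CochainComplex.HomComplex.CohomologyClass.mk_eq_zero_iff] at h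
      rw [CochainComplex.HomComplex.Cocycle.toSingleMk_mem_coboundaries_iff _ _ _ _ _ 1
        (by simp)] at h
      obtain ⟨g, hg⟩ := h
      have hz : g = 0 := (CochainComplex.isZero_of_isStrictlyLE P.cochainComplex 0 1).eq_of_src _ _
      rw [← cancel_epi (P.cochainComplexXIso (-(0 : ℕ)) 0 rfl).hom, ← hg, hz]
      simp
    · rintro ⟨g, hg⟩
      have : f = 0 := by rw [← hg]; simp
      subst this
      exact P.extMk_zero _ rfl

lemma exists_resHom {X X' : ModuleCat.{0} R} (g : X' ⟶ X) (P' : ProjectiveResolution X')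
    (P : ProjectiveResolution X) : Nonempty (ProjectiveResolution.Hom P' P g) := by
  refine ⟨⟨ProjectiveResolution.lift g P' P, ?_⟩⟩
  have := ProjectiveResolution.lift_commutes g P' P
  exact congrArg (fun f => f.f 0) this

/-- old and new Ext classes given by the same cocycle -/
def Rel {X Y : ModuleCat.{0} R} {n : ℕ}
    (e : (((Ext R (ModuleCat.{0} R) n).obj (op X)).obj Y : ModuleCat R))
    (e' : Abelian.Ext X Y n) : Prop :=
  ∃ z : ((projectiveResolution X).complex.linearYonedaObj R Y).cycles n,
    oldMk (projectiveResolution X) n z = e ∧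
    (projectiveResolution X).extMk (toHom z) (n+1) rfl (toHom_d z _) = e'

lemma Rel.left {X Y : ModuleCat.{0} R} {n : ℕ}
    (e : (((Ext R (ModuleCat.{0} R) n).obj (op X)).obj Y : ModuleCat R)) :
    ∃ e' : Abelian.Ext X Y n, Rel e e' := by
  obtain ⟨z, hz⟩ := oldMk_surj (projectiveResolution X) n e
  exact ⟨_, z, hz, rfl⟩

lemma Rel.right {X Y : ModuleCat.{0} R} {n : ℕ} (e' : Abelian.Ext X Y n) :
    ∃ e : (((Ext R (ModuleCat.{0} R) n).obj (op X)).obj Y : ModuleCat R), Rel e e' := by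
  obtain ⟨f, hf, h⟩ := (projectiveResolution X).extMk_surjective e' (n+1) rfl
  obtain ⟨z, hz⟩ := toHom_surj f hf
  subst hz
  exact ⟨_, z, rfl, h⟩

lemma Rel.zero_iff {X Y : ModuleCat.{0} R} {n : ℕ}
    {e : (((Ext R (ModuleCat.{0} R) n).obj (op X)).obj Y : ModuleCat R)}
    {e' : Abelian.Ext X Y n} (h : Rel e e') : e = 0 ↔ e' = 0 := by
  obtain ⟨z, rfl, rfl⟩ := h
  rw [oldMk_eq_zero_iff, extMk_eq_zero_iff']

lemma Rel.map {X X' Y : ModuleCat.{0} R} {n : ℕ} (g : X' ⟶ X)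
    {e : (((Ext R (ModuleCat.{0} R) n).obj (op X)).obj Y : ModuleCat R)}
    {e' : Abelian.Ext X Y n} (h : Rel e e') :
    Rel (((Ext R (ModuleCat.{0} R) n).map g.op).app Y e)
      ((Abelian.Ext.mk₀ g).comp e' (zero_add n)) := by
  obtain ⟨z, rfl, rfl⟩ := h
  obtain ⟨φ⟩ := exists_resHom g (projectiveResolution X') (projectiveResolution X)
  obtain ⟨z', h1, h2⟩ := oldMk_map g _ _ φ n z
  refine ⟨z', h1.symm, ?_⟩
  rw [ProjectiveResolution.mk₀_comp_extMk _ _ _ _ φ]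
  congr 1

lemma old_subsingleton_iff {X Y : ModuleCat.{0} R} {n : ℕ} :
    Subsingleton (((Ext R (ModuleCat.{0} R) n).obj (op X)).obj Y : ModuleCat R) ↔
    Subsingleton (Abelian.Ext X Y n) := by
  constructor
  · intro h
    refine subsingleton_of_forall_eq 0 fun e' => ?_
    obtain ⟨e, he⟩ := Rel.right e'
    exact he.zero_iff.1 (Subsingleton.elim _ _)
  · intro h
    refine subsingleton_of_forall_eq 0 fun e => ?_
    obtain ⟨e', he⟩ := Rel.left e
    exact he.zero_iff.2 (Subsingleton.elim _ _)

/-- the projection `R/a^m → R/a^n` -/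
def proj (a : Ideal R) {n m : ℕ} (h : n ≤ m) :
    ModuleCat.of R (R ⧸ a ^ m) ⟶ ModuleCat.of R (R ⧸ a ^ n) :=
  (localCohomology.ringModIdeals (localCohomology.idealPowersDiagram a)).map (homOfLE h).op

/-- vanishing of local cohomology in terms of `Abelian.Ext` -/
def V (a : Ideal R) (i : ℕ) (Y : ModuleCat.{0} R) : Prop :=
  ∀ (n : ℕ) (e : Abelian.Ext (ModuleCat.of R (R ⧸ a ^ n)) Y i), ∃ (m : ℕ) (h : n ≤ m),
    (Abelian.Ext.mk₀ (proj a h)).comp e (zero_add i) = 0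

lemma V_iff (a : Ideal R) (i : ℕ) (Y : ModuleCat.{0} R) :
    V a i Y ↔ Subsingleton ((localCohomology a i).obj Y) := by
  let D := localCohomology.diagram (localCohomology.idealPowersDiagram a) i
  let F := D ⋙ (evaluation _ _).obj Y
  let c : Cocone F := ((evaluation _ _).obj Y).mapCocone (colimit.cocone D)
  have hc : IsColimit c := isColimitOfPreserves _ (colimit.isColimit D)
  change _ ↔ Subsingleton c.pt
  have key : ∀ (j : ℕᵒᵖᵒᵖ) (x : F.obj j), c.ι.app j x = 0 ↔ ∃ (k : _) (f : j ⟶ k), F.map f x = 0 := by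
    intro j x
    constructor
    · intro h
      have h0 : c.ι.app j x = c.ι.app j (0 : F.obj j) := by rw [h, map_zero]
      obtain ⟨k, f, g, hfg⟩ := (Concrete.isColimit_rep_eq_iff_exists F hc x (0 : F.obj j)).1 h0
      exact ⟨k, f, by rw [hfg, map_zero]⟩
    · rintro ⟨k, f, hf⟩
      have h0 := congrArg (fun g => g.hom x) (c.w f)
      refine h0.symm.trans ?_
      change c.ι.app k (F.map f x) = 0
      rw [hf, map_zero]
  constructor
  · intro hV
    refine subsingleton_of_forall_eq 0 fun x => ?_
    obtain ⟨j, y, rfl⟩ := Concrete.isColimit_exists_rep F hc x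
    rw [key]
    obtain ⟨e', he⟩ := Rel.left (X := ModuleCat.of R (R ⧸ a ^ (j.unop.unop))) (Y := Y) y
    obtain ⟨m, h, hm⟩ := hV _ e'
    refine ⟨op (op m), (homOfLE h).op.op, ?_⟩
    exact (he.map (proj a h)).zero_iff.2 hm
  · intro hs n e'
    obtain ⟨e, he⟩ := Rel.right e'
    obtain ⟨k, f, hf⟩ := (key (op (op n)) e).1 (hs.elim _ _)
    refine ⟨k.unop.unop, leOfHom f.unop.unop, ?_⟩
    exact (he.map (proj a _)).zero_iff.1 hf

open Abelian (Ext.mk₀)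

lemma proj_comp (a : Ideal R) {n m k : ℕ} (h : n ≤ m) (h' : m ≤ k) :
    proj a h' ≫ proj a h = proj a (h.trans h') := by
  exact ((localCohomology.ringModIdeals (localCohomology.idealPowersDiagram a)).map_comp
    (homOfLE h').op (homOfLE h).op).symm

lemma proj_one (a : Ideal R) {n m : ℕ} (h : n ≤ m) :
    proj a h (Submodule.Quotient.mk (1 : R)) = (Submodule.Quotient.mk (1 : R)) := rfl

lemma kill_trans (a : Ideal R) {n m k : ℕ} (h : n ≤ m) (h' : m ≤ k) {Y : ModuleCat.{0} R} {i : ℕ}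
    (e : Abelian.Ext (ModuleCat.of R (R ⧸ a ^ n)) Y i) :
    (Ext.mk₀ (proj a h')).comp ((Ext.mk₀ (proj a h)).comp e (zero_add i)) (zero_add i) =
    (Ext.mk₀ (proj a (h.trans h'))).comp e (zero_add i) := by
  rw [Abelian.Ext.mk₀_comp_mk₀_assoc, proj_comp]

section
variable {S : ShortComplex (ModuleCat.{0} R)} (hS : S.ShortExact) (a : Ideal R)
include hS

lemma V_mid {i : ℕ} (h1 : V a i S.X₁) (h3 : V a i S.X₃) : V a i S.X₂ := by
  intro n e
  obtain ⟨m, h, hm⟩ := h3 n (e.comp (Ext.mk₀ S.g) (add_zero i))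
  rw [← Abelian.Ext.comp_assoc_of_third_deg_zero] at hm
  obtain ⟨e', he'⟩ := Abelian.Ext.covariant_sequence_exact₂ _ hS _ hm
  obtain ⟨k, h', hk⟩ := h1 m e'
  refine ⟨k, h.trans h', ?_⟩
  rw [← kill_trans a h h', ← he', ← Abelian.Ext.comp_assoc_of_third_deg_zero, hk]
  simp

lemma V_left {i : ℕ} (h3 : V a i S.X₃) (h2 : V a (i+1) S.X₂) : V a (i+1) S.X₁ := by
  intro n e
  obtain ⟨m, h, hm⟩ := h2 n (e.comp (Ext.mk₀ S.f) (add_zero _))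
  rw [← Abelian.Ext.comp_assoc_of_third_deg_zero] at hm
  obtain ⟨e', he'⟩ := Abelian.Ext.covariant_sequence_exact₁ _ hS _ hm rfl
  obtain ⟨k, h', hk⟩ := h3 m e'
  refine ⟨k, h.trans h', ?_⟩
  rw [← kill_trans a h h', ← he', ← Abelian.Ext.comp_assoc (a₁₂ := i) (a₂₃ := i + 1), hk]
  · simp
  all_goals simp

lemma V_right {i : ℕ} (h2 : V a i S.X₂) (h1 : V a (i+1) S.X₁) : V a i S.X₃ := by
  intro n e
  obtain ⟨m, h, hm⟩ := h1 n (e.comp hS.extClass rfl)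
  rw [← Abelian.Ext.comp_assoc (a₁₂ := i) (a₂₃ := i + 1) _ _ _ (by simp) (by simp) (by simp)] at hm
  obtain ⟨e', he'⟩ := Abelian.Ext.covariant_sequence_exact₃ _ hS _ rfl hm
  obtain ⟨k, h', hk⟩ := h2 m e'
  refine ⟨k, h.trans h', ?_⟩
  rw [← kill_trans a h h', ← he', ← Abelian.Ext.comp_assoc_of_third_deg_zero, hk]
  simp
end

lemma V_of_subsingleton (a : Ideal R) {i : ℕ} {Y : ModuleCat.{0} R}
    (h : ∀ n : ℕ, 1 ≤ n → ∀ e : Abelian.Ext (ModuleCat.of R (R ⧸ a ^ n)) Y i, e = 0) : V a i Y := by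
  intro n e
  exact ⟨n+1, by omega, h _ (by omega) _⟩

lemma V_injective (a : Ideal R) (i : ℕ) (Y : ModuleCat.{0} R) [Injective Y] : V a (i+1) Y :=
  V_of_subsingleton a fun _ _ e => Abelian.Ext.eq_zero_of_injective e

lemma V_bot (i : ℕ) (Y : ModuleCat.{0} R) : V (⊥ : Ideal R) (i+1) Y := by
  refine V_of_subsingleton _ fun n hn e => ?_
  have : (⊥ : Ideal R) ^ n = ⊥ := by
    rw [← Ideal.zero_eq_bot, zero_pow (by omega)]
  have : Projective (ModuleCat.of R (R ⧸ (⊥ : Ideal R) ^ n)) := by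
    rw [this]
    have e : (R ⧸ (⊥ : Ideal R)) ≃ₗ[R] R := Submodule.quotEquivOfEqBot ⊥ rfl
    have : Module.Projective R (R ⧸ (⊥ : Ideal R)) := Module.Projective.of_equiv e.symm
    infer_instance
  exact Abelian.Ext.eq_zero_of_projective e

lemma V_bij (a : Ideal R) (x : R) (hx : x ∈ a) (i : ℕ) (Y : ModuleCat.{0} R)
    (h : Function.Bijective (fun y : Y => x • y)) : V a i Y := by
  refine V_of_subsingleton _ fun n hn e => ?_
  have hY : Function.Bijective (fun y : Y => x ^ n • y) := by
    have := h.iterate n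
    convert this using 1
    ext y
    rw [smul_iterate]
  have h1 : x ^ n • e = 0 := by
    have h2 : e = (Ext.mk₀ (𝟙 _)).comp e (zero_add i) := by simp
    rw [h2, ← Abelian.Ext.smul_comp, ← Abelian.Ext.mk₀_smul]
    have : x ^ n • 𝟙 (ModuleCat.of R (R ⧸ a ^ n)) = 0 := by
      ext
      simp
      rw [← map_one (Ideal.Quotient.mk (a ^ n)), ← Ideal.Quotient.mk_eq_mk, ← Submodule.Quotient.mk_smul]
      rw [Submodule.Quotient.mk_eq_zero]
      simpa using Ideal.pow_mem_pow hx n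
    rw [this]; simp
  rw [Abelian.Ext.smul_eq_comp_mk₀] at h1
  have : IsIso (x ^ n • 𝟙 Y) := by
    rw [ConcreteCategory.isIso_iff_bijective]
    exact hY
  have h3 := congrArg (fun t => t.comp (Ext.mk₀ (inv (x ^ n • 𝟙 Y))) (add_zero i)) h1
  simpa using h3

/-- torsion elements -/
def T (a : Ideal R) {M : Type} [AddCommGroup M] [Module R M] (x : M) : Prop :=
  ∃ n : ℕ, ∀ r ∈ a ^ n, r • x = 0

lemma T_hom (a : Ideal R) {n : ℕ} {Y : ModuleCat.{0} R}
    (g : ModuleCat.of R (R ⧸ a ^ n) ⟶ Y) :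
    ∀ r ∈ a ^ n, r • g (Submodule.Quotient.mk (1 : R)) = 0 := by
  intro r hr
  have : r • (Submodule.Quotient.mk (1 : R) : R ⧸ a ^ n) = 0 := by
    rw [← Submodule.Quotient.mk_smul, Submodule.Quotient.mk_eq_zero]
    simpa using hr
  refine (map_smul g.hom r _).symm.trans ?_
  rw [this, map_zero]

lemma hom_ext_one (a : Ideal R) {n : ℕ} {Y : ModuleCat.{0} R}
    (f g : ModuleCat.of R (R ⧸ a ^ n) ⟶ Y)
    (h : f (Submodule.Quotient.mk (1 : R)) = g (Submodule.Quotient.mk (1 : R))) : f = g := by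
  ext
  exact h

lemma exists_hom (a : Ideal R) {n : ℕ} {Y : ModuleCat.{0} R} (y : Y) (hy : ∀ r ∈ a ^ n, r • y = 0) :
    ∃ g : ModuleCat.of R (R ⧸ a ^ n) ⟶ Y, g (Submodule.Quotient.mk (1 : R)) = y := by
  refine ⟨ModuleCat.ofHom (Submodule.liftQ (a ^ n) (LinearMap.toSpanSingleton R Y y) ?_), ?_⟩
  · intro r hr
    change r • y = 0
    exact hy r hr
  · change (1 : R) • y = y
    exact one_smul _ _

lemma V_zero_iff (a : Ideal R) (Y : ModuleCat.{0} R) : V a 0 Y ↔ ∀ y : Y, T a y → y = 0 := by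
  constructor
  · rintro h y ⟨n, hn⟩
    obtain ⟨g, hg⟩ := exists_hom a y hn
    obtain ⟨m, hm, h0⟩ := h n (Ext.mk₀ g)
    rw [Abelian.Ext.mk₀_comp_mk₀, Abelian.Ext.mk₀_eq_zero_iff] at h0
    have := congrArg (fun f => f.hom (Submodule.Quotient.mk (1 : R))) h0
    rw [← hg]
    exact this
  · intro h n e
    obtain ⟨g, rfl⟩ := (Abelian.Ext.mk₀_bijective _ _).2 e
    refine ⟨n, le_rfl, ?_⟩
    have : g = 0 := hom_ext_one a _ _ (h _ ⟨n, T_hom a g⟩)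
    simp [this]

section
variable {S : ShortComplex (ModuleCat.{0} R)} (hS : S.ShortExact) (a : Ideal R)
include hS
lemma V_one_lift (h : V a 1 S.X₁) (q : S.X₃) (hq : T a q) : ∃ e : S.X₂, T a e ∧ S.g e = q := by
  obtain ⟨n, hn⟩ := hq
  obtain ⟨g, hg⟩ := exists_hom a q hn
  obtain ⟨m, hm, h0⟩ := h n ((Ext.mk₀ g).comp hS.extClass (zero_add 1))
  rw [Abelian.Ext.mk₀_comp_mk₀_assoc] at h0
  obtain ⟨e', he'⟩ := Abelian.Ext.covariant_sequence_exact₃ _ hS _ _ h0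
  obtain ⟨l, rfl⟩ := (Abelian.Ext.mk₀_bijective _ _).2 e'
  rw [Abelian.Ext.mk₀_comp_mk₀] at he'
  have := (Abelian.Ext.mk₀_bijective _ _).1 he'
  refine ⟨l (Submodule.Quotient.mk (1 : R)), ⟨m, T_hom a l⟩, ?_⟩
  have := congrArg (fun f => f.hom (Submodule.Quotient.mk (1 : R))) this
  exact this.trans hg

lemma V_one_of_lift [Injective S.X₂]
    (h : ∀ q : S.X₃, T a q → ∃ e : S.X₂, T a e ∧ S.g e = q) : V a 1 S.X₁ := by
  intro n e
  obtain ⟨e', rfl⟩ := Abelian.Ext.covariant_sequence_exact₁ _ hS e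
    (Abelian.Ext.eq_zero_of_injective (n := 0) _) (zero_add 1)
  obtain ⟨g, rfl⟩ := (Abelian.Ext.mk₀_bijective _ _).2 e'
  obtain ⟨y, ⟨k, hk⟩, hy⟩ := h _ ⟨n, T_hom a g⟩
  obtain ⟨l, hl⟩ := exists_hom a (n := max n k) y
    (fun r hr => hk r (Ideal.pow_le_pow_right (le_max_right _ _) hr))
  refine ⟨max n k, le_max_left _ _, ?_⟩
  have : proj a (le_max_left n k) ≫ g = l ≫ S.g := by
    apply hom_ext_one
    change g _ = S.g (l _)
    rw [hl, hy]
    rfl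
  rw [Abelian.Ext.mk₀_comp_mk₀_assoc, this, ← Abelian.Ext.mk₀_comp_mk₀_assoc]
  simp
end
lemma ses {A B C : Type} [AddCommGroup A] [Module R A] [AddCommGroup B] [Module R B]
    [AddCommGroup C] [Module R C] (f : A →ₗ[R] B) (g : B →ₗ[R] C) (hf : Function.Injective f)
    (hg : Function.Surjective g) (h : Function.Exact f g) :
    (ShortComplex.mk (ModuleCat.ofHom f) (ModuleCat.ofHom g)
      (by ext x; exact h.apply_apply_eq_zero x)).ShortExact := by
  have : Mono (ModuleCat.ofHom f) := (ModuleCat.mono_iff_injective _).2 hf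
  have : Epi (ModuleCat.ofHom g) := (ModuleCat.epi_iff_surjective _).2 hg
  exact ShortComplex.ShortExact.mk' ((ShortComplex.ShortExact.moduleCat_exact_iff_function_exact _).2 h)
    ‹_› ‹_›

lemma inj_ext {E A B : Type} [AddCommGroup E] [Module R E] [Module.Injective R E]
    [AddCommGroup A] [Module R A] [AddCommGroup B] [Module R B] (f : A →ₗ[R] B) (g : A →ₗ[R] E)
    (h : ∀ x, f x = 0 → g x = 0) : ∃ h : B →ₗ[R] E, ∀ x, h (f x) = g x := by
  have hk : LinearMap.ker f ≤ LinearMap.ker g := fun x hx => h x hx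
  obtain ⟨k, hk'⟩ := Module.Injective.out ((LinearMap.ker f).liftQ f le_rfl)
    (by rw [← LinearMap.ker_eq_bot]; exact Submodule.ker_liftQ_eq_bot _ _ _ le_rfl)
    ((LinearMap.ker f).liftQ g hk)
  exact ⟨k, fun x => hk' (Submodule.Quotient.mk x)⟩

lemma T_mono (c : Ideal R) {M : Type} [AddCommGroup M] [Module R M] {x : M} {n m : ℕ} (h : n ≤ m)
    (hx : ∀ r ∈ c ^ n, r • x = 0) : ∀ r ∈ c ^ m, r • x = 0 :=
  fun r hr => hx r (Ideal.pow_le_pow_right h hr)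

lemma T_map (c : Ideal R) {M N : Type} [AddCommGroup M] [Module R M] [AddCommGroup N] [Module R N]
    (f : M →ₗ[R] N) {x : M} (h : T c x) : T c (f x) := by
  obtain ⟨n, hn⟩ := h
  exact ⟨n, fun r hr => by rw [← map_smul, hn r hr, map_zero]⟩

lemma T_of_inj (c : Ideal R) {M N : Type} [AddCommGroup M] [Module R M] [AddCommGroup N] [Module R N]
    (f : M →ₗ[R] N) (hf : Function.Injective f) {x : M} (h : T c (f x)) : T c x := by
  obtain ⟨n, hn⟩ := h
  exact ⟨n, fun r hr => hf (by rw [map_smul, hn r hr, map_zero])⟩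

/-- torsion submodule -/
def Γ (c : Ideal R) (M : Type) [AddCommGroup M] [Module R M] : Submodule R M where
  carrier := {x | T c x}
  zero_mem' := ⟨0, fun r _ => smul_zero r⟩
  add_mem' := by
    rintro x y ⟨n, hn⟩ ⟨m, hm⟩
    refine ⟨max n m, fun r hr => ?_⟩
    rw [smul_add, T_mono c (le_max_left n m) hn r hr, T_mono c (le_max_right n m) hm r hr, add_zero]
  smul_mem' := by
    rintro s x ⟨n, hn⟩
    exact ⟨n, fun r hr => by rw [smul_comm, hn r hr, smul_zero]⟩

lemma Γ_T (c : Ideal R) (M : Type) [AddCommGroup M] [Module R M] (x : Γ c M) : T c x :=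
  T_of_inj c (Γ c M).subtype Subtype.val_injective x.2

lemma Γ_injective [IsNoetherianRing R] (c : Ideal R) (E : Type) [AddCommGroup E] [Module R E]
    [Module.Injective R E] : Module.Injective R (Γ c E) := by
  apply Module.Baer.injective
  intro J g
  let K : ℕ →o Submodule R J :=
    { toFun := fun k =>
        { carrier := {x | ∀ r ∈ c ^ k, r • g x = 0}
          zero_mem' := fun r _ => by rw [map_zero, smul_zero]
          add_mem' := fun {x y} hx hy r hr => by rw [map_add, smul_add, hx r hr, hy r hr, add_zero]
          smul_mem' := fun s x hx r hr => by rw [map_smul, smul_comm, hx r hr, smul_zero] }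
      monotone' := fun n m h x hx => T_mono c h hx }
  obtain ⟨k, hk⟩ := monotone_stabilizes_iff_noetherian.2 (inferInstance : IsNoetherian R J) K
  have hk' : ∀ x : J, ∀ r ∈ c ^ k, r • g x = 0 := by
    intro x
    obtain ⟨n, hn⟩ := Γ_T c E (g x)
    have : x ∈ K (max k n) := T_mono c (le_max_right k n) hn
    rw [← hk _ (le_max_left k n)] at this
    exact this
  obtain ⟨l, hl⟩ := Ideal.exists_pow_inf_eq_pow_smul c (M := R) J
  have h1 : ∀ x (hx : x ∈ J), x ∈ c ^ (k + l) → g ⟨x, hx⟩ = 0 := by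
    intro x hx hxc
    have h2 : x ∈ (c ^ (k + l) • ⊤ : Submodule R R) ⊓ J := ⟨by simpa using hxc, hx⟩
    rw [hl _ (by omega), Nat.add_sub_cancel] at h2
    have h3 : c ^ k • (c ^ l • ⊤ ⊓ J) ≤ (LinearMap.ker g).map J.subtype := by
      rw [Submodule.smul_le]
      intro r hr y hy
      refine ⟨r • ⟨y, hy.2⟩, ?_, rfl⟩
      change g _ = 0
      rw [map_smul, hk' _ r hr]
    obtain ⟨⟨y, hy⟩, h4, rfl⟩ := h3 h2
    exact h4
  obtain ⟨h, hh⟩ := inj_ext (E := E) ((c ^ (k + l)).mkQ ∘ₗ J.subtype) ((Γ c E).subtype ∘ₗ g) (by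
    rintro ⟨x, hx⟩ h0
    have h0 : (Submodule.Quotient.mk x : R ⧸ c ^ (k + l)) = 0 := h0
    rw [Submodule.Quotient.mk_eq_zero] at h0
    change (g ⟨x, hx⟩ : E) = 0
    rw [h1 x hx h0]; rfl)
  have hm : ∀ r : R, r • h (Submodule.Quotient.mk 1) = h (Submodule.Quotient.mk r) := by
    intro r
    rw [← map_smul, ← Submodule.Quotient.mk_smul, smul_eq_mul, mul_one]
  refine ⟨LinearMap.toSpanSingleton R _ ⟨h (Submodule.Quotient.mk 1), k + l, fun r hr => ?_⟩, ?_⟩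
  · rw [hm, (Submodule.Quotient.mk_eq_zero _).2 hr, map_zero]
  · intro x hx
    apply Subtype.ext
    change x • h (Submodule.Quotient.mk 1) = _
    rw [hm]
    exact hh ⟨x, hx⟩

lemma emb0 (M : Type) [AddCommGroup M] [Module R M] :
    ∃ (E : ModuleCat.{0} R) (f : M →ₗ[R] E), Module.Injective R E ∧ Function.Injective f := by
  refine ⟨Injective.under (ModuleCat.of R M), (Injective.ι (ModuleCat.of R M)).hom, ?_, ?_⟩
  · exact Module.injective_module_of_injective_object (inj := Injective.injective_under (ModuleCat.of R M)) R _
  · exact (ModuleCat.mono_iff_injective _).1 inferInstance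

lemma emb [IsNoetherianRing R] (c : Ideal R) (M : Type) [AddCommGroup M] [Module R M]
    (hM : ∀ x : M, T c x) :
    ∃ (E : ModuleCat.{0} R) (f : M →ₗ[R] E), Module.Injective R E ∧ Function.Injective f ∧
      ∀ x : E, T c x := by
  obtain ⟨E, f, hE, hf⟩ := emb0 (R := R) M
  refine ⟨ModuleCat.of R (Γ c E), f.codRestrict (Γ c E) (fun x => T_map c f (hM x)),
    Γ_injective c E, ?_, Γ_T c E⟩
  intro x y h
  exact hf (congrArg Subtype.val h)

lemma TL [IsNoetherianRing R] (c a b : Ideal R)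
    (H : ∀ (M : Type) [AddCommGroup M] [Module R M], (∀ x : M, T c x) → ∀ x : M, T a x ↔ T b x)
    (i : ℕ) : ∀ (M : Type) [AddCommGroup M] [Module R M], (∀ x : M, T c x) →
      V b (i+1) (ModuleCat.of R M) → V a (i+1) (ModuleCat.of R M) := by
  induction i with
  | zero =>
    intro M _ _ hM h
    obtain ⟨E, f, hE, hf, hT⟩ := emb c M hM
    have hS := ses f (LinearMap.range f).mkQ hf (Submodule.mkQ_surjective _)
      (LinearMap.exact_map_mkQ_range f)
    have hQ : ∀ q : E ⧸ LinearMap.range f, T c q := by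
      intro q
      obtain ⟨e, rfl⟩ := Submodule.mkQ_surjective _ q
      exact T_map c _ (hT e)
    have : Injective (ModuleCat.of R E) := Module.injective_object_of_injective_module R E
    refine V_one_of_lift hS a (fun q hq => ?_)
    obtain ⟨e, he, he'⟩ := V_one_lift hS b h q ((H _ hQ q).1 hq)
    exact ⟨e, (H _ hT e).2 he, he'⟩
  | succ i ih =>
    intro M _ _ hM h
    obtain ⟨E, f, hE, hf, hT⟩ := emb c M hM
    have hS := ses f (LinearMap.range f).mkQ hf (Submodule.mkQ_surjective _)
      (LinearMap.exact_map_mkQ_range f)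
    have hQ : ∀ q : E ⧸ LinearMap.range f, T c q := by
      intro q
      obtain ⟨e, rfl⟩ := Submodule.mkQ_surjective _ q
      exact T_map c _ (hT e)
    have : Injective (ModuleCat.of R E) := Module.injective_object_of_injective_module R E
    exact V_left hS a (ih _ hQ (V_right hS b (V_injective b i _) h)) (V_injective a (i+1) _)

lemma V_torsion [IsNoetherianRing R] (a : Ideal R) (i : ℕ) (M : Type) [AddCommGroup M] [Module R M]
    (hM : ∀ x : M, T a x) : V a (i+1) (ModuleCat.of R M) := by
  refine TL a a ⊥ (fun N _ _ hN x => ⟨fun _ => ⟨1, fun r hr => ?_⟩, fun _ => hN x⟩) i M hM (V_bot i _)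
  rw [pow_one] at hr
  rw [Ideal.mem_bot.1 hr, zero_smul]

lemma T_sup (x : R) (b : Ideal R) (M : Type) [AddCommGroup M] [Module R M]
    (hM : ∀ y : M, T (Ideal.span {x}) y) (y : M) : T (Ideal.span {x} ⊔ b) y ↔ T b y := by
  constructor
  · rintro ⟨n, hn⟩
    exact ⟨n, fun r hr => hn r (Ideal.pow_right_mono le_sup_right n hr)⟩
  · rintro ⟨n, hn⟩
    obtain ⟨k, hk⟩ := hM y
    refine ⟨k + n, fun r hr => ?_⟩
    obtain ⟨s, hs, t, ht, rfl⟩ := Submodule.mem_sup.1 (Ideal.sup_pow_add_le_pow_sup_pow hr)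
    rw [add_smul, hk s hs, hn t ht, add_zero]

lemma T_span (x : R) {M : Type} [AddCommGroup M] [Module R M] (y : M) (n : ℕ) (h : x ^ n • y = 0) :
    T (Ideal.span {x}) y := by
  refine ⟨n, fun r hr => ?_⟩
  rw [Ideal.span_singleton_pow, Ideal.mem_span_singleton'] at hr
  obtain ⟨s, rfl⟩ := hr
  rw [mul_smul, h, smul_zero]

lemma bounded [IsNoetherianRing R] (s : Finset R) :
    ∃ r : ℕ, ∀ (M : Type) [AddCommGroup M] [Module R M], ∀ i > r,
      V (Ideal.span (s : Set R)) i (ModuleCat.of R M) := by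
  classical
  induction s using Finset.induction_on with
  | empty =>
    refine ⟨0, fun M _ _ i hi => ?_⟩
    obtain ⟨j, rfl⟩ := Nat.exists_eq_succ_of_ne_zero hi.ne'
    rw [Finset.coe_empty, Ideal.span_empty]
    exact V_bot j _
  | insert x s _ ih =>
    obtain ⟨r, hr⟩ := ih
    refine ⟨r + 1, fun M _ _ i hi => ?_⟩
    rw [Finset.coe_insert, Ideal.span_insert]
    set b := Ideal.span (s : Set R)
    have ht : ∀ (N : Type) [AddCommGroup N] [Module R N], (∀ y : N, T (Ideal.span {x}) y) →
        ∀ i > r, V (Ideal.span {x} ⊔ b) i (ModuleCat.of R N) := by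
      intro N _ _ hN i hi
      obtain ⟨j, rfl⟩ := Nat.exists_eq_succ_of_ne_zero (by omega : i ≠ 0)
      exact TL _ _ b (fun N _ _ hN y => T_sup x b N hN y) j N hN (hr N _ hi)
    let L := LocalizedModule (Submonoid.powers x) M
    let f : M →ₗ[R] L := LocalizedModule.mkLinearMap (Submonoid.powers x) M
    have hK : ∀ y : LinearMap.ker f, T (Ideal.span {x}) y := by
      rintro ⟨y, hy⟩
      obtain ⟨⟨_, n, rfl⟩, hc⟩ := (IsLocalizedModule.eq_zero_iff (Submonoid.powers x) f).1 hy
      exact T_span x _ n (Subtype.ext hc)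
    have hC : ∀ y : L ⧸ LinearMap.range f, T (Ideal.span {x}) y := by
      intro q
      obtain ⟨y, rfl⟩ := Submodule.mkQ_surjective _ q
      obtain ⟨⟨m, ⟨_, n, rfl⟩⟩, hc⟩ := IsLocalizedModule.surj (Submonoid.powers x) f y
      refine T_span x _ n ?_
      rw [← map_smul]
      exact (Submodule.Quotient.mk_eq_zero _).2 ⟨m, hc.symm⟩
    have hL : Function.Bijective (fun y : L => x • y) :=
      (Module.End.isUnit_iff _).1 (IsLocalizedModule.map_units f
        (⟨x, 1, pow_one x⟩ : Submonoid.powers x))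
    have h1 := ses (LinearMap.ker f).subtype f.rangeRestrict Subtype.val_injective
      f.surjective_rangeRestrict (by
        intro y
        rw [← LinearMap.mem_ker, LinearMap.ker_rangeRestrict]
        simp)
    have h2 := ses (LinearMap.range f).subtype (LinearMap.range f).mkQ Subtype.val_injective
      (Submodule.mkQ_surjective _) (by
        intro y
        rw [← LinearMap.mem_ker, Submodule.ker_mkQ]
        simp)
    obtain ⟨j, rfl⟩ := Nat.exists_eq_succ_of_ne_zero (by omega : i ≠ 0)
    refine V_mid h1 _ (ht _ hK _ (by omega)) (V_left h2 _ (ht _ hC _ (by omega)) ?_)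
    exact V_bij _ x (Ideal.mem_sup_left (Ideal.mem_span_singleton_self x)) _ _ hL
lemma nontrivial_iff (a : Ideal R) (i : ℕ) (M : Type) [AddCommGroup M] [Module R M] :
    Nontrivial ((localCohomology a i).obj (ModuleCat.of R M)) ↔ ¬ V a i (ModuleCat.of R M) := by
  rw [V_iff, not_subsingleton_iff_nontrivial]

lemma V_congr (a : Ideal R) (i : ℕ) {M N : Type} [AddCommGroup M] [Module R M]
    [AddCommGroup N] [Module R N] (e : M ≃ₗ[R] N) :
    V a i (ModuleCat.of R M) ↔ V a i (ModuleCat.of R N) := by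
  rw [V_iff, V_iff]
  exact ((localCohomology a i).mapIso e.toModuleIso).toLinearEquiv.toEquiv.subsingleton_congr

lemma cohDim_congr (a : Ideal R) {M N : Type} [AddCommGroup M] [Module R M]
    [AddCommGroup N] [Module R N] (e : M ≃ₗ[R] N) : cohDim a M = cohDim a N := by
  unfold cohDim
  simp only [nontrivial_iff, V_congr a _ e]

lemma isRelCM_congr (a : Ideal R) {M N : Type} [AddCommGroup M] [Module R M]
    [AddCommGroup N] [Module R N] (e : M ≃ₗ[R] N) : IsRelCM a M ↔ IsRelCM a N := by
  unfold IsRelCM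
  simp only [nontrivial_iff, V_congr a _ e]

lemma cohDim_le_iff [IsNoetherianRing R] (a : Ideal R) (n : ℕ) (M : Type) [AddCommGroup M]
    [Module R M] : cohDim a M ≤ n ↔ ∀ i > n, V a i (ModuleCat.of R M) := by
  obtain ⟨s, hs⟩ : a.FG := IsNoetherian.noetherian a
  obtain ⟨r, hr⟩ := bounded s
  have hb : BddAbove {i : ℕ | Nontrivial ((localCohomology a i).obj (ModuleCat.of R M))} := by
    refine ⟨r, fun i hi => ?_⟩
    by_contra h
    refine (nontrivial_iff a i M).1 hi ?_
    rw [← hs]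
    exact hr M i (by omega)
  constructor
  · intro h i hi
    by_contra h'
    have : i ≤ cohDim a M := le_csSup hb ((nontrivial_iff a i M).2 h')
    omega
  · intro h
    refine csSup_le' fun i hi => ?_
    by_contra h'
    exact (nontrivial_iff a i M).1 hi (h i (by omega))

lemma free_emb [IsNoetherianRing R] (a : Ideal R) (X : Type) [AddCommGroup X] [Module R X]
    (hX : ∀ x : X, T a x → x = 0) :
    ∃ (E : ModuleCat.{0} R) (f : X →ₗ[R] E), Module.Injective R E ∧ Function.Injective f ∧
      ∀ x : E, T a x → x = 0 := by
  obtain ⟨E, f, hE, hf⟩ := emb0 (R := R) X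
  have := Γ_injective a E
  obtain ⟨p, hp⟩ := inj_ext (E := Γ a E) (Γ a E).subtype LinearMap.id
    (fun x hx => Subtype.ext hx)
  let s : (E ⧸ Γ a E) →ₗ[R] E := (Γ a E).liftQ (LinearMap.id - (Γ a E).subtype ∘ₗ p) (by
    intro x hx
    change x - (p x : E) = 0
    have := hp ⟨x, hx⟩
    rw [sub_eq_zero]
    exact (congrArg Subtype.val this).symm)
  have hs : ∀ q, (Γ a E).mkQ (s q) = q := by
    intro q
    obtain ⟨x, rfl⟩ := Submodule.mkQ_surjective _ q
    change (Γ a E).mkQ (x - (p x : E)) = _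
    rw [map_sub, sub_eq_self]
    exact (Submodule.Quotient.mk_eq_zero _).2 (p x).2
  refine ⟨ModuleCat.of R (E ⧸ Γ a E), (Γ a E).mkQ ∘ₗ f, ⟨?_⟩, ?_, ?_⟩
  · intro A B _ _ _ _ u hu g
    obtain ⟨h, hh⟩ := Module.Injective.out u hu (s ∘ₗ g)
    refine ⟨(Γ a E).mkQ ∘ₗ h, fun x => ?_⟩
    change (Γ a E).mkQ (h (u x)) = _
    rw [hh]
    exact hs _
  · rw [injective_iff_map_eq_zero]
    intro x hx
    exact hX x (T_of_inj a f hf ((Submodule.Quotient.mk_eq_zero _).1 hx))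
  · intro q hq
    have h1 : s q ∈ Γ a E := T_map a s hq
    rw [← hs q]
    exact (Submodule.Quotient.mk_eq_zero _).2 h1

lemma ext_zero (a : Ideal R) (X : Type) [AddCommGroup X] [Module R X]
    (hX : ∀ x : X, T a x → x = 0) :
    Subsingleton (Abelian.Ext (ModuleCat.of R (R ⧸ a)) (ModuleCat.of R X) 0) := by
  suffices h : Subsingleton (Abelian.Ext (ModuleCat.of R (R ⧸ a ^ 1)) (ModuleCat.of R X) 0) by
    rwa [pow_one] at h
  refine subsingleton_of_forall_eq 0 fun e => ?_
  obtain ⟨g, rfl⟩ := (Abelian.Ext.mk₀_bijective _ _).2 e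
  have : g = 0 := hom_ext_one a _ _ (hX _ ⟨1, T_hom a g⟩)
  simp [this]

lemma ext_one [IsNoetherianRing R] (a : Ideal R) (X : Type) [AddCommGroup X] [Module R X]
    (hX : ∀ x : X, T a x → x = 0)
    (h : Subsingleton (Abelian.Ext (ModuleCat.of R (R ⧸ a)) (ModuleCat.of R X) 1)) :
    V a 1 (ModuleCat.of R X) := by
  have h : Subsingleton (Abelian.Ext (ModuleCat.of R (R ⧸ a ^ 1)) (ModuleCat.of R X) 1) := by
    rwa [pow_one]
  obtain ⟨E, f, hE, hf, hT⟩ := free_emb a X hX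
  have hS := ses f (LinearMap.range f).mkQ hf (Submodule.mkQ_surjective _)
    (LinearMap.exact_map_mkQ_range f)
  have : Injective (ModuleCat.of R E) := Module.injective_object_of_injective_module R E
  have h1 : ∀ q : E ⧸ LinearMap.range f, (∀ r ∈ a ^ 1, r • q = 0) → q = 0 := by
    intro q hq
    obtain ⟨g, hg⟩ := exists_hom (Y := ModuleCat.of R (E ⧸ LinearMap.range f)) a q hq
    obtain ⟨e', he'⟩ := Abelian.Ext.covariant_sequence_exact₃ _ hS (Ext.mk₀ g) (zero_add 1)
      (h.elim _ _)
    obtain ⟨l, rfl⟩ := (Abelian.Ext.mk₀_bijective _ _).2 e'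
    rw [Abelian.Ext.mk₀_comp_mk₀] at he'
    have h2 := (Abelian.Ext.mk₀_bijective _ _).1 he'
    have h3 : l = 0 := hom_ext_one a _ _ (hT _ ⟨1, T_hom a l⟩)
    rw [h3, zero_comp] at h2
    rw [← hg, ← h2]
    rfl
  have h2 : ∀ (n : ℕ) (q : E ⧸ LinearMap.range f), (∀ r ∈ a ^ n, r • q = 0) → q = 0 := by
    intro n
    induction n with
    | zero =>
      intro q hq
      have := hq 1 (by simp)
      rwa [one_smul] at this
    | succ n ih =>
      intro q hq
      refine ih q fun r hr => h1 _ fun t ht => ?_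
      rw [← mul_smul]
      apply hq
      rw [pow_succ']
      exact Ideal.mul_mem_mul (by simpa using ht) hr
  refine V_one_of_lift hS a ?_
  rintro q ⟨n, hn⟩
  refine ⟨0, ⟨0, fun r _ => smul_zero r⟩, ?_⟩
  rw [map_zero]
  exact (h2 n q hn).symm

section
variable [IsNoetherianRing R] (a : Ideal R) (M : Type) [AddCommGroup M] [Module R M]

lemma main_V (h1 : cohDim a M = 1) (N : Submodule R M) (hN : cohDim a N ≤ 0)
    (hmax : ∀ N' : Submodule R M, cohDim a N' ≤ 0 → N' ≤ N) :
    (∀ i, V a i (ModuleCat.of R (M ⧸ N)) ↔ i ≠ 1) ∧ ∀ x : M ⧸ N, T a x → x = 0 := by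
  have hM2 := (cohDim_le_iff a 1 M).1 h1.le
  have hM1 : ¬ V a 1 (ModuleCat.of R M) := by
    intro h
    have : cohDim a M ≤ 0 := (cohDim_le_iff a 0 M).2 fun i hi => by
      rcases eq_or_ne i 1 with rfl | h'
      · exact h
      · exact hM2 i (by omega)
    omega
  have hN1 := (cohDim_le_iff a 0 N).1 hN
  have hΓ : Γ a M ≤ N := hmax _ ((cohDim_le_iff a 0 _).2 fun i hi => by
    obtain ⟨j, rfl⟩ := Nat.exists_eq_succ_of_ne_zero (by omega : i ≠ 0)
    exact V_torsion a j _ (Γ_T a M))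
  have hS := ses N.subtype N.mkQ Subtype.val_injective (Submodule.mkQ_surjective _) (by
    intro y
    rw [← LinearMap.mem_ker, Submodule.ker_mkQ]
    simp)
  have hT : ∀ x : M ⧸ N, T a x → x = 0 := by
    intro q hq
    obtain ⟨e, he, rfl⟩ := V_one_lift hS a (hN1 1 (by omega)) q hq
    exact (Submodule.Quotient.mk_eq_zero _).2 (hΓ he)
  refine ⟨fun i => ⟨?_, fun hi => ?_⟩, hT⟩
  · rintro h rfl
    exact hM1 (V_mid hS a (hN1 1 (by omega)) h)
  · rcases Nat.eq_zero_or_pos i with rfl | h0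
    · exact (V_zero_iff a _).2 hT
    · exact V_right hS a (hM2 i (by omega)) (hN1 _ (by omega))

lemma main_quot (h1 : cohDim a M = 1) (N : Submodule R M) (hN : cohDim a N ≤ 0)
    (hmax : ∀ N' : Submodule R M, cohDim a N' ≤ 0 → N' ≤ N) :
    IsRelCM a (M ⧸ N) ∧ gradeI a (M ⧸ N) = 1 ∧ cohDim a (M ⧸ N) = 1 := by
  obtain ⟨hV, hT⟩ := main_V a M h1 N hN hmax
  have hn : ∀ i, Nontrivial ((localCohomology a i).obj (ModuleCat.of R (M ⧸ N))) ↔ i = 1 := by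
    intro i
    rw [nontrivial_iff, hV, not_not]
  refine ⟨⟨1, hn⟩, ?_, ?_⟩
  · unfold gradeI
    have h0 : (1 : ℕ) ∈ {i : ℕ | Nontrivial
        (((Ext R (ModuleCat R) i).obj (Opposite.op (ModuleCat.of R (R ⧸ a)))).obj
          (ModuleCat.of R (M ⧸ N)))} := by
      change Nontrivial _
      rw [← not_subsingleton_iff_nontrivial, old_subsingleton_iff]
      intro h
      exact (hV 1).1 (ext_one a _ hT h) rfl
    refine le_antisymm (Nat.sInf_le h0) (le_csInf ⟨_, h0⟩ ?_)
    intro i hi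
    by_contra h
    obtain rfl : i = 0 := by omega
    change Nontrivial _ at hi
    rw [← not_subsingleton_iff_nontrivial, old_subsingleton_iff] at hi
    exact hi (ext_zero a _ hT)
  · unfold cohDim
    simp only [hn]
    simp

lemma main_rcmf (h1 : cohDim a M = 1) : IsRCMF a M := by
  intro F hF i hi hi'
  rw [h1] at hF hi'
  obtain rfl : i = 1 := by omega
  right
  obtain ⟨hN, hmax⟩ := hF 0 (by omega)
  have htop : F 1 = ⊤ := top_le_iff.1 ((hF 1 le_rfl).2 ⊤
    (by rw [cohDim_congr a Submodule.topEquiv, h1]))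
  let e0 : F 1 ≃ₗ[R] M := (LinearEquiv.ofEq _ _ htop).trans Submodule.topEquiv
  let e : filtFactor F 1 ≃ₗ[R] (M ⧸ F 0) :=
    Submodule.Quotient.equiv (Submodule.comap (F 1).subtype (F (1 - 1))) (F 0) e0 (by
      ext x
      constructor
      · rintro ⟨y, hy, rfl⟩
        exact hy
      · intro hx
        exact ⟨⟨x, by rw [htop]; trivial⟩, hx, rfl⟩)
  obtain ⟨h2, -, h3⟩ := main_quot a M h1 (F 0) hN hmax
  exact ⟨(isRelCM_congr a e).2 h2, (cohDim_congr a e).trans h3⟩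
end
end LC
end

/-- Example 2.7(b): every finite `R`-module `M` with `cd(𝔞,M) = 1` is RCMF w.r.t. `𝔞`; in
particular, with cd-filtration `M₀ ⊆ M₁ = M`, the quotient `M/M₀` is relative
Cohen-Macaulay w.r.t. `𝔞` with `grade(𝔞,M/M₀) = cd(𝔞,M/M₀) = 1`. -/
theorem stmt15 {R : Type} [CommRing R] [IsNoetherianRing R]
    (𝔞 : Ideal R) (h𝔞 : 𝔞 ≠ ⊤)
    (M : Type) [AddCommGroup M] [Module R M] [Module.Finite R M]
    (h1 : cohDim 𝔞 M = 1) :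
    IsRCMF 𝔞 M ∧
      ∀ F : ℕ → Submodule R M, IsCdFiltration 𝔞 1 F →
        IsRelCM 𝔞 (M ⧸ F 0) ∧ gradeI 𝔞 (M ⧸ F 0) = 1 ∧ cohDim 𝔞 (M ⧸ F 0) = 1 := by
  refine ⟨LC.main_rcmf 𝔞 M h1, fun F hF => ?_⟩
  obtain ⟨hN, hmax⟩ := hF 0 (by omega)
  exact LC.main_quot 𝔞 M h1 (F 0) hN hmax
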